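/- In the switched-feedback setup, the identity I(X1 ; Yd, Z | X2) = H(X1|X2) − p·H(X1 | Y, X2) holds. In particular, if H(X1 | Y, X2) = 0 then I(X1 ; Yd, Z | X2) = H(X1|X2). -/

import Mathlib

open MeasureTheory

namespace SF

variable {Ω : Type*} [MeasurableSpace Ω]

/-- The probability that a random variable `X` takes the value `a`. -/
noncomputable def pr (μ : Measure Ω) {A : Type*} (X : Ω → A) (a : A) : ℝ :=
  (μ (X ⁻¹' {a})).toReal

/-- Shannon entropy (natural logarithm) of a finite-valued random variable. -/
noncomputable def ent (μ : Measure Ω) {A : Type*} [Fintype A] (X : Ω → A) : ℝ :=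
  ∑ a, Real.negMulLog (pr μ X a)

/-- Conditional entropy `H(X | Y)`. -/
noncomputable def condEnt (μ : Measure Ω) {A B : Type*} [Fintype A] [Fintype B]
    (X : Ω → A) (Y : Ω → B) : ℝ :=
  ent μ (fun ω => (X ω, Y ω)) - ent μ Y

/-- Mutual information `I(X ; Y)`. -/
noncomputable def mi (μ : Measure Ω) {A B : Type*} [Fintype A] [Fintype B]
    (X : Ω → A) (Y : Ω → B) : ℝ :=
  ent μ X + ent μ Y - ent μ (fun ω => (X ω, Y ω))

/-- Conditional mutual information `I(X ; Y | Z)`. -/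
noncomputable def cmi (μ : Measure Ω) {A B C : Type*} [Fintype A] [Fintype B] [Fintype C]
    (X : Ω → A) (Y : Ω → B) (Z : Ω → C) : ℝ :=
  ent μ (fun ω => (X ω, Z ω)) + ent μ (fun ω => (Y ω, Z ω))
    - ent μ (fun ω => (X ω, Y ω, Z ω)) - ent μ Z

end SF

open SF MeasureTheory

namespace SF

section Entropy

variable {Ω : Type*} [MeasurableSpace Ω] {μ : Measure Ω}

open scoped Classical in
lemma pr_comp_eq_sum [IsFiniteMeasure μ] {A B : Type*} [Fintype A] {X : Ω → A}
    (hX : ∀ a, MeasurableSet (X ⁻¹' {a})) (g : A → B) (b : B) :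
    pr μ (fun ω => g (X ω)) b = ∑ a, if g a = b then pr μ X a else 0 := by
  have h : (fun ω => g (X ω)) ⁻¹' {b} = X ⁻¹' ↑(Finset.univ.filter fun a => g a = b) := by
    ext ω; simp
  rw [← Finset.sum_filter]
  simp only [pr]
  rw [h, ← sum_measure_preimage_singleton _ fun a _ => hX a,
    ENNReal.toReal_sum fun a _ => measure_ne_top _ _]

lemma sum_pr_eq_one [IsProbabilityMeasure μ] {A : Type*} [Fintype A] {X : Ω → A}
    (hX : ∀ a, MeasurableSet (X ⁻¹' {a})) : ∑ a, pr μ X a = 1 := by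
  simp only [pr]
  rw [← ENNReal.toReal_sum fun a _ => measure_ne_top _ _,
    sum_measure_preimage_singleton _ fun a _ => hX a]
  simp

lemma measurableSet_preimage_singleton_comp {A B : Type*} [Finite A] {X : Ω → A}
    (hX : ∀ a, MeasurableSet (X ⁻¹' {a})) (g : A → B) (b : B) :
    MeasurableSet ((fun ω => g (X ω)) ⁻¹' {b}) := by
  have h : (fun ω => g (X ω)) ⁻¹' {b} = ⋃ a ∈ {a | g a = b}, X ⁻¹' {a} := by
    ext ω; simp
  rw [h]
  exact .biUnion (Set.to_countable _) fun a _ => hX a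

lemma ent_comp_of_injective {A B : Type*} [Fintype A] [Fintype B] (X : Ω → A) {φ : A → B}
    (hφ : Function.Injective φ) : ent μ (fun ω => φ (X ω)) = ent μ X := by
  refine (Fintype.sum_of_injective φ hφ _ _ (fun b hb => ?_) fun a => ?_).symm
  · have h : (fun ω => φ (X ω)) ⁻¹' {b} = ∅ := by
      ext ω
      simpa using fun h => hb ⟨X ω, h⟩
    simp [pr, h]
  · have h : (fun ω => φ (X ω)) ⁻¹' {φ a} = X ⁻¹' {a} := by
      ext ω
      simp [hφ.eq_iff]
    simp [pr, h]

/-- The entropy of a variable that is `f W` or `g W` according to an independent, observable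
switch `V`. -/
lemma ent_switch [IsProbabilityMeasure μ] {A B C : Type*} [Fintype A] [Fintype B] [Fintype C]
    {V : Ω → Bool} {W : Ω → A} (hmeas : ∀ d, MeasurableSet ((fun ω => (V ω, W ω)) ⁻¹' {d}))
    (hindep : ∀ v a, pr μ (fun ω => (V ω, W ω)) (v, a) = pr μ V v * pr μ W a)
    (f : A → B) (g : A → C) :
    ent μ (fun ω => if V ω then Sum.inl (f (W ω)) else Sum.inr (g (W ω)) : Ω → B ⊕ C)
      = ent μ V + pr μ V true * ent μ (fun ω => f (W ω))
        + pr μ V false * ent μ (fun ω => g (W ω)) := by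
  classical
  have hW : ∀ a, MeasurableSet (W ⁻¹' {a}) :=
    measurableSet_preimage_singleton_comp hmeas Prod.snd
  let σ : Bool × A → B ⊕ C := fun d => if d.1 then Sum.inl (f d.2) else Sum.inr (g d.2)
  have hl (b : B) : pr μ (fun ω => σ (V ω, W ω)) (Sum.inl b)
      = pr μ V true * pr μ (fun ω => f (W ω)) b := by
    rw [pr_comp_eq_sum hmeas, pr_comp_eq_sum hW, Fintype.sum_prod_type, Finset.mul_sum]
    simp [σ, hindep]
  have hr (c : C) : pr μ (fun ω => σ (V ω, W ω)) (Sum.inr c)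
      = pr μ V false * pr μ (fun ω => g (W ω)) c := by
    rw [pr_comp_eq_sum hmeas, pr_comp_eq_sum hW, Fintype.sum_prod_type, Finset.mul_sum]
    simp [σ, hindep]
  change ent μ (fun ω => σ (V ω, W ω)) = _
  simp only [ent, Fintype.sum_sum_type, hl, hr, Real.negMulLog_mul, Finset.sum_add_distrib,
    ← Finset.sum_mul, ← Finset.mul_sum, Fintype.sum_bool,
    sum_pr_eq_one (measurableSet_preimage_singleton_comp hW f),
    sum_pr_eq_one (measurableSet_preimage_singleton_comp hW g)]
  ring

end Entropy

end SF

/-- Switched-feedback setup: `(X1,X2,Y)` are finite-valued random variables,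
`V ~ Bernoulli(p)` is independent of `(X1,X2,Y)`; `Yd = Y` if `V = 1` and `Yd = e` if
`V = 0`; `Z = (X1,X2)` if `V = 0` and `Z = e` if `V = 1` (the fresh symbol `e` is
modelled by `none` in `Option`). Then `I(X1 ; Yd, Z | X2) = H(X1|X2) − p·H(X1 | Y, X2)`;
in particular, if `H(X1 | Y, X2) = 0` then `I(X1 ; Yd, Z | X2) = H(X1|X2)`. -/
theorem statement9 {Ω : Type*} [MeasurableSpace Ω] (μ : Measure Ω) [IsProbabilityMeasure μ]
    {A1 A2 AY : Type*} [Fintype A1] [Fintype A2] [Fintype AY]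
    (X1 : Ω → A1) (X2 : Ω → A2) (Y : Ω → AY) (V : Ω → Bool)
    (p : ℝ) (hp0 : 0 ≤ p) (hp1 : p ≤ 1)
    (hp : pr μ V true = p)
    (hmeas : ∀ (a : A1) (b : A2) (y : AY) (v : Bool),
      MeasurableSet ((fun ω => (X1 ω, X2 ω, Y ω, V ω)) ⁻¹' {(a, b, y, v)}))
    (hindep : ∀ (v : Bool) (a : A1) (b : A2) (y : AY),
      pr μ (fun ω => (V ω, X1 ω, X2 ω, Y ω)) (v, a, b, y)
        = pr μ V v * pr μ (fun ω => (X1 ω, X2 ω, Y ω)) (a, b, y)) :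
    cmi μ X1
        (fun ω => ((if V ω then some (Y ω) else none),
                   (if V ω then none else some (X1 ω, X2 ω)))) X2
      = condEnt μ X1 X2 - p * condEnt μ X1 (fun ω => (Y ω, X2 ω))
    ∧ (condEnt μ X1 (fun ω => (Y ω, X2 ω)) = 0 →
        cmi μ X1
          (fun ω => ((if V ω then some (Y ω) else none),
                     (if V ω then none else some (X1 ω, X2 ω)))) X2
        = condEnt μ X1 X2) := by
  have hD : ∀ d, MeasurableSet ((fun ω => (V ω, X1 ω, X2 ω, Y ω)) ⁻¹' {d}) :=
    measurableSet_preimage_singleton_comp (X := fun ω => (X1 ω, X2 ω, Y ω, V ω))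
      (fun t => hmeas t.1 t.2.1 t.2.2.1 t.2.2.2) fun t => (t.2.2.2, t.1, t.2.1, t.2.2.1)
  let φ : (AY × A2) ⊕ (A1 × A2) → (Option AY × Option (A1 × A2)) × A2 :=
    Sum.elim (fun t => ((some t.1, none), t.2)) fun t => ((none, some t), t.2)
  let ψ : (A1 × AY × A2) ⊕ (A1 × A2) → A1 × (Option AY × Option (A1 × A2)) × A2 :=
    Sum.elim (fun t => (t.1, (some t.2.1, none), t.2.2)) fun t => (t.1, (none, some t), t.2)
  have hφ : Function.Injective φ := by
    rintro (⟨a, b⟩ | ⟨a, b⟩) (⟨c, d⟩ | ⟨c, d⟩) <;> simp +contextual [φ]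
  have hψ : Function.Injective ψ := by
    rintro (⟨a, b, c⟩ | ⟨a, b⟩) (⟨d, e, f⟩ | ⟨d, e⟩) <;> simp +contextual [ψ]
  have e₁ := ent_switch hD (fun v w => hindep v w.1 w.2.1 w.2.2)
    (fun w => (w.2.2, w.2.1)) fun w => (w.1, w.2.1)
  have e₂ := ent_switch hD (fun v w => hindep v w.1 w.2.1 w.2.2)
    (fun w => (w.1, w.2.2, w.2.1)) fun w => (w.1, w.2.1)
  rw [← ent_comp_of_injective _ hφ] at e₁
  rw [← ent_comp_of_injective _ hψ] at e₂
  have s₁ : (fun ω => (((if V ω then some (Y ω) else none),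
      (if V ω then none else some (X1 ω, X2 ω))), X2 ω)) = fun ω => φ (if V ω
        then Sum.inl (Y ω, X2 ω) else Sum.inr (X1 ω, X2 ω)) := by
    funext ω
    cases V ω <;> simp [φ]
  have s₂ : (fun ω => (X1 ω, ((if V ω then some (Y ω) else none),
      (if V ω then none else some (X1 ω, X2 ω))), X2 ω)) = fun ω => ψ (if V ω
        then Sum.inl (X1 ω, Y ω, X2 ω) else Sum.inr (X1 ω, X2 ω)) := by
    funext ω
    cases V ω <;> simp [ψ]
  have main : cmi μ X1
        (fun ω => ((if V ω then some (Y ω) else none),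
                   (if V ω then none else some (X1 ω, X2 ω)))) X2
      = condEnt μ X1 X2 - p * condEnt μ X1 (fun ω => (Y ω, X2 ω)) := by
    simp only [cmi, condEnt]
    rw [s₁, s₂, e₁, e₂, hp]
    ring
  exact ⟨main, fun h => by rw [main, h, mul_zero, sub_zero]⟩
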